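/- Assume Hypotheses (H_C) and (H_G). Let K ⊆ ℝⁿ be closed with C(t) ∩ K ≠ ∅ for all t ≥ 0, and set 𝒢 := {(t,x) ∈ [0,∞) × ℝⁿ : x ∈ C(t) ∩ K}. Then the following are equivalent: (a) (strong invariance) for every (t₀,x₀) ∈ 𝒢, every T > t₀ and every solution x of the perturbed sweeping process on [t₀,T] with x(t₀) = x₀, one has x(t) ∈ K for all t ∈ [t₀,T]; (b) for every (t,x) ∈ 𝒢 and every p ∈ N^P_𝒢(t,x) one has min{(0,−ξ)·p : ξ ∈ N_{C(t)}(x), ‖ξ‖ ≤ L_C + M} + max{(1,g)·p : g ∈ G(t,x)} ≤ 0. -/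

import Mathlib

open scoped Pointwise RealInnerProductSpace ENNReal
open Set Metric MeasureTheory

variable {E : Type*} [NormedAddCommGroup E] [InnerProductSpace ℝ E]

/-- Proximal normal cone to `K` at `x` (empty when `x ∉ K`):
`v ∈ N_K(x)` iff `x ∈ K` and there is `σ ≥ 0` with `⟪v, y - x⟫ ≤ σ‖y - x‖²` for all `y ∈ K`. -/
def proxNormalCone (K : Set E) (x : E) : Set E :=
  {v | x ∈ K ∧ ∃ σ : ℝ, 0 ≤ σ ∧ ∀ y ∈ K, ⟪v, y - x⟫ ≤ σ * ‖y - x‖ ^ 2}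

/-- `r`-prox-regularity of a closed set. -/
def ProxRegular (r : ℝ) (C : Set E) : Prop :=
  ∀ x ∈ C, ∀ y ∈ C, ∀ ζ ∈ proxNormalCone C x,
    ⟪ζ, y - x⟫ ≤ 1 / (2 * r) * ‖ζ‖ * ‖y - x‖ ^ 2

/-- Hypothesis (H_C): values are nonempty, compact, `r`-prox-regular; `L_C`-Lipschitz
for the Hausdorff distance. -/
structure HypC (r L_C : ℝ) (C : ℝ → Set E) : Prop where
  nonempty : ∀ t, 0 ≤ t → (C t).Nonempty
  isCompact : ∀ t, 0 ≤ t → IsCompact (C t)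
  proxRegular : ∀ t, 0 ≤ t → ProxRegular r (C t)
  lipschitz : ∀ s t, 0 ≤ s → 0 ≤ t → hausdorffDist (C s) (C t) ≤ L_C * |s - t|

/-- Hypothesis (H_G): nonempty, closed, convex values, bounded by `M`, `L_G`-Lipschitz
for the Hausdorff distance. -/
structure HypG (M L_G : ℝ) (G : ℝ → E → Set E) : Prop where
  nonempty : ∀ t x, (G t x).Nonempty
  isClosed : ∀ t x, IsClosed (G t x)
  convex : ∀ t x, Convex ℝ (G t x)
  bounded : ∀ t x, ∀ v ∈ G t x, ‖v‖ ≤ M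
  lipschitz : ∀ s t (x y : E), hausdorffDist (G s x) (G t y) ≤ L_G * (|s - t| + ‖x - y‖)

/-- Solution of the perturbed sweeping process `ẋ(t) ∈ -N_{C(t)}(x(t)) + G(t, x(t))`
on `[t0, T]`: an (absolutely continuous) integral of an integrable derivative `x'`
satisfying the differential inclusion a.e., with `x(t) ∈ C(t)` for all `t ∈ [t0, T]`. -/
def IsSweepingSol (C : ℝ → Set E) (G : ℝ → E → Set E) (t0 T : ℝ) (x : ℝ → E) : Prop :=
  (∀ t ∈ Icc t0 T, x t ∈ C t) ∧
  ∃ x' : ℝ → E, IntegrableOn x' (Icc t0 T) ∧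
    (∀ t ∈ Icc t0 T, x t = x t0 + ∫ s in t0..t, x' s) ∧
    ∀ᵐ t ∂(volume.restrict (Icc t0 T)),
      x' t ∈ -proxNormalCone (C t) (x t) + G t (x t)

/-- Minimum time to reach the target `S` subject to the perturbed sweeping process,
starting at `x0 ∈ C t0` at time `t0` (`+∞` if `S` is never reached). -/
noncomputable def minTime (C : ℝ → Set E) (G : ℝ → E → Set E) (S : Set E)
    (t0 : ℝ) (x0 : E) : ℝ≥0∞ :=
  sInf (ENNReal.ofReal '' {a : ℝ | 0 ≤ a ∧ ∃ x : ℝ → E,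
    IsSweepingSol C G t0 (t0 + a) x ∧ x t0 = x0 ∧ x (t0 + a) ∈ S})

/-- Proximal normal cone in the product space `ℝ × E` (with the Euclidean product
inner product `⟪(a,v),(b,w)⟫ = a*b + ⟪v,w⟫`). -/
def proxNormalCone2 (K : Set (ℝ × E)) (q : ℝ × E) : Set (ℝ × E) :=
  {p | q ∈ K ∧ ∃ σ : ℝ, 0 ≤ σ ∧ ∀ q' ∈ K,
    p.1 * (q'.1 - q.1) + ⟪p.2, q'.2 - q.2⟫ ≤ σ * ((q'.1 - q.1) ^ 2 + ‖q'.2 - q.2‖ ^ 2)}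

/-- Proximal normal cone in the product space `ℝ × E × ℝ`. -/
def proxNormalCone3 (K : Set (ℝ × E × ℝ)) (q : ℝ × E × ℝ) : Set (ℝ × E × ℝ) :=
  {p | q ∈ K ∧ ∃ σ : ℝ, 0 ≤ σ ∧ ∀ q' ∈ K,
    p.1 * (q'.1 - q.1) + ⟪p.2.1, q'.2.1 - q.2.1⟫ + p.2.2 * (q'.2.2 - q.2.2) ≤
      σ * ((q'.1 - q.1) ^ 2 + ‖q'.2.1 - q.2.1‖ ^ 2 + (q'.2.2 - q.2.2) ^ 2)}

/-- Proximal normal cone in the product space `E × ℝ`. -/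
def proxNormalConeER (K : Set (E × ℝ)) (q : E × ℝ) : Set (E × ℝ) :=
  {p | q ∈ K ∧ ∃ σ : ℝ, 0 ≤ σ ∧ ∀ q' ∈ K,
    ⟪p.1, q'.1 - q.1⟫ + p.2 * (q'.2 - q.2) ≤ σ * (‖q'.1 - q.1‖ ^ 2 + (q'.2 - q.2) ^ 2)}

/-- The graph of the moving set `C`, i.e. `{(t,x) : t ≥ 0, x ∈ C(t)}`. -/
def graphSet (C : ℝ → Set E) : Set (ℝ × E) := {q | 0 ≤ q.1 ∧ q.2 ∈ C q.1}

open Filter Topology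

section Hypotheses

variable {r L_C M L_G Λ : ℝ} {C : ℝ → Set E} {G : ℝ → E → Set E}

lemma exists_mem_norm_sub_le_of_hausdorffDist {F : Type*} [NormedAddCommGroup F] {s t : Set F}
    (hs : IsCompact s) (ht : IsCompact t) (htn : t.Nonempty) {d : ℝ} (hd : hausdorffDist s t ≤ d)
    {x : F} (hx : x ∈ s) :
    ∃ y ∈ t, ‖x - y‖ ≤ d := by
  obtain ⟨y, hy, hxy⟩ := ht.exists_infDist_eq_dist htn x
  refine ⟨y, hy, ?_⟩
  rw [← dist_eq_norm, ← hxy]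
  exact (infDist_le_hausdorffDist_of_mem hx
    (hausdorffEDist_ne_top_of_nonempty_of_bounded ⟨x, hx⟩ htn hs.isBounded ht.isBounded)).trans hd

lemma HypC.lipschitz_nonneg (hC : HypC r L_C C) : 0 ≤ L_C := by
  have h := hausdorffDist_nonneg.trans (hC.lipschitz 0 1 le_rfl zero_le_one)
  simpa using h

lemma HypG.bound_nonneg (hG : HypG M L_G G) : 0 ≤ M := by
  obtain ⟨v, hv⟩ := hG.nonempty 0 0
  exact (norm_nonneg v).trans (hG.bounded 0 0 v hv)

lemma HypG.lipschitz_nonneg (hG : HypG M L_G G) : 0 ≤ L_G := by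
  have h := hausdorffDist_nonneg.trans (hG.lipschitz 0 1 0 0)
  simpa using h

lemma HypC.exists_near (hC : HypC r L_C C) {s t : ℝ} (hs : 0 ≤ s) (ht : 0 ≤ t) {x : E}
    (hx : x ∈ C s) : ∃ y ∈ C t, ‖x - y‖ ≤ L_C * |s - t| :=
  exists_mem_norm_sub_le_of_hausdorffDist (hC.isCompact s hs) (hC.isCompact t ht)
    (hC.nonempty t ht) (hC.lipschitz s t hs ht) hx

lemma HypG.isCompact [FiniteDimensional ℝ E] (hG : HypG M L_G G) (t : ℝ) (x : E) :
    IsCompact (G t x) := by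
  have := FiniteDimensional.proper_real E
  refine Metric.isCompact_of_isClosed_isBounded (hG.isClosed t x) ?_
  exact isBounded_iff_forall_norm_le.2 ⟨M, hG.bounded t x⟩

lemma HypG.exists_near [FiniteDimensional ℝ E] (hG : HypG M L_G G) {s t : ℝ} {x y : E} {v : E}
    (hv : v ∈ G s x) : ∃ w ∈ G t y, ‖v - w‖ ≤ L_G * (|s - t| + ‖x - y‖) :=
  exists_mem_norm_sub_le_of_hausdorffDist (hG.isCompact s x) (hG.isCompact t y)
    (hG.nonempty t y) (hG.lipschitz s t x y) hv

/-- Quantitative stability of the prox-regularity inequality under perturbation of the time, of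
the base point and of the test point. -/
lemma HypC.inner_le (hC : HypC r L_C C) (hr : 0 < r) {t t' δ : ℝ} (ht : 0 ≤ t) (ht' : 0 ≤ t')
    {a a' c ζ : E} (hζ : ζ ∈ proxNormalCone (C t) a) (hΛ : ‖ζ‖ ≤ Λ) (hc : c ∈ C t')
    (hδ : L_C * |t - t'| + ‖a - a'‖ ≤ δ) :
    ⟪ζ, c - a'⟫ ≤ Λ * δ + Λ / (2 * r) * (‖c - a'‖ + δ) ^ 2 := by
  obtain ⟨c', hc', hcc⟩ := hC.exists_near ht' ht hc
  rw [abs_sub_comm] at hcc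
  have h1 := hC.proxRegular t ht a hζ.1 c' hc' ζ hζ
  have hsplit : c - a' = (c' - a) + ((c - c') + (a - a')) := by abel
  have hn : ‖(c - c') + (a - a')‖ ≤ δ := (norm_add_le _ _).trans (by linarith)
  have hn0 := norm_nonneg ((c - c') + (a - a'))
  have h2 : ‖c' - a‖ ≤ ‖c - a'‖ + δ := by
    have : c' - a = (c - a') - ((c - c') + (a - a')) := by abel
    rw [this]
    exact (norm_sub_le _ _).trans (by linarith)
  have h3 : ⟪ζ, (c - c') + (a - a')⟫ ≤ Λ * δ :=
    (real_inner_le_norm _ _).trans (mul_le_mul hΛ hn hn0 ((norm_nonneg ζ).trans hΛ))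
  have hΛ0 := (norm_nonneg ζ).trans hΛ
  have h4 : 1 / (2 * r) * ‖ζ‖ * ‖c' - a‖ ^ 2 ≤ Λ / (2 * r) * (‖c - a'‖ + δ) ^ 2 := by
    rw [one_div_mul_eq_div]
    gcongr
  have h5 : ⟪ζ, c - a'⟫ = ⟪ζ, c' - a⟫ + ⟪ζ, (c - c') + (a - a')⟫ := by
    rw [← inner_add_right, ← hsplit]
  linarith

/-- The catching-up algorithm with step `h`. -/
lemma exists_catching_up [FiniteDimensional ℝ E] (hC : HypC r L_C C) (hG : HypG M L_G G)
    {t₀ h : ℝ} (ht₀ : 0 ≤ t₀) (hh : 0 < h) {x₀ g₀ : E} (hx₀ : x₀ ∈ C t₀) (hg₀ : g₀ ∈ G t₀ x₀) :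
    ∃ X g ξ : ℕ → E, X 0 = x₀ ∧ ∀ k : ℕ,
      X k ∈ C (t₀ + k * h) ∧ g k ∈ G (t₀ + k * h) (X k) ∧
      ‖g k - g₀‖ ≤ L_G * (k * h + ‖X k - x₀‖) ∧
      ξ k ∈ proxNormalCone (C (t₀ + (k + 1) * h)) (X (k + 1)) ∧ ‖ξ k‖ ≤ L_C + M ∧
      X (k + 1) = X k + h • (g k - ξ k) := by
  have htk : ∀ k : ℕ, 0 ≤ t₀ + k * h := fun k => by positivity
  have hg : ∀ (k : ℕ) (x : E), ∃ g ∈ G (t₀ + k * h) x, ‖g - g₀‖ ≤ L_G * (k * h + ‖x - x₀‖) := by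
    intro k x
    obtain ⟨g, hg, hgg⟩ := hG.exists_near (t := t₀ + k * h) (y := x) hg₀
    refine ⟨g, hg, ?_⟩
    rw [norm_sub_rev]
    refine hgg.trans_eq ?_
    rw [norm_sub_rev x₀ x, sub_add_cancel_left, abs_neg, abs_of_nonneg (by positivity)]
  choose γ hγ hγ' using hg
  have hP : ∀ (k : ℕ) (x : E), ∃ y ∈ C (t₀ + (k + 1 : ℕ) * h),
      infDist (x + h • γ k x) (C (t₀ + (k + 1 : ℕ) * h)) = dist (x + h • γ k x) y := fun k x =>
    (hC.isCompact _ (htk _)).exists_infDist_eq_dist (hC.nonempty _ (htk _)) _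
  choose P hP hP' using hP
  let X : ℕ → E := fun k => Nat.rec x₀ (fun k x => P k x) k
  have hX : ∀ k, X (k + 1) = P k (X k) := fun k => rfl
  have hXC : ∀ k : ℕ, X k ∈ C (t₀ + k * h) := by
    intro k
    cases k with
    | zero => simpa [X] using hx₀
    | succ k => rw [hX]; exact hP k _
  refine ⟨X, fun k => γ k (X k), fun k => h⁻¹ • (X k + h • γ k (X k) - X (k + 1)), rfl, fun k =>
    ⟨hXC k, hγ k _, hγ' k _, ?_, ?_, ?_⟩⟩
  · have hmem : X (k + 1) ∈ C (t₀ + (k + 1) * h) := by simpa using hXC (k + 1)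
    refine ⟨hmem, h⁻¹ / 2, by positivity, fun y hy => ?_⟩
    have hd : ‖X k + h • γ k (X k) - X (k + 1)‖ ≤ ‖X k + h • γ k (X k) - y‖ := by
      rw [← dist_eq_norm, ← dist_eq_norm, hX, ← hP' k (X k)]
      exact infDist_le_dist_of_mem (by simpa using hy)
    set z := X k + h • γ k (X k) - X (k + 1) with hz
    have hz' : X k + h • γ k (X k) - y = z - (y - X (k + 1)) := by rw [hz]; abel
    rw [hz'] at hd
    have hsq : ‖z‖ ^ 2 ≤ ‖z - (y - X (k + 1))‖ ^ 2 := by gcongr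
    rw [norm_sub_sq_real z] at hsq
    rw [real_inner_smul_left]
    have : ⟪z, y - X (k + 1)⟫ ≤ ‖y - X (k + 1)‖ ^ 2 / 2 := by linarith
    calc h⁻¹ * ⟪z, y - X (k + 1)⟫ ≤ h⁻¹ * (‖y - X (k + 1)‖ ^ 2 / 2) := by gcongr
      _ = _ := by ring
  · obtain ⟨y, hy, hyy⟩ := hC.exists_near (htk k) (htk (k + 1)) (hXC k)
    have habs : |t₀ + k * h - (t₀ + (k + 1 : ℕ) * h)| = h := by
      push_cast
      rw [show t₀ + k * h - (t₀ + (k + 1) * h) = -h by ring, abs_neg, abs_of_pos hh]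
    rw [habs] at hyy
    have hd : ‖X k + h • γ k (X k) - X (k + 1)‖ ≤ ‖X k + h • γ k (X k) - y‖ := by
      rw [← dist_eq_norm, ← dist_eq_norm, hX, ← hP' k (X k)]
      exact infDist_le_dist_of_mem hy
    have hγM : ‖h • γ k (X k)‖ ≤ h * M := by
      rw [norm_smul, Real.norm_of_nonneg hh.le]
      have := hG.bounded _ _ _ (hγ k (X k))
      gcongr
    have h2 : ‖X k + h • γ k (X k) - y‖ ≤ L_C * h + h * M := by
      rw [show X k + h • γ k (X k) - y = (X k - y) + h • γ k (X k) by abel]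
      exact (norm_add_le _ _).trans (add_le_add hyy hγM)
    rw [norm_smul, norm_inv, Real.norm_of_nonneg hh.le, inv_mul_le_iff₀ hh]
    linarith
  · rw [smul_sub, smul_inv_smul₀ hh.ne']
    abel

end Hypotheses

section PolygonalLimits

/-- The index of the last point of the grid `t₀ + h ℕ` before `s`. -/
noncomputable def gridIndex (t₀ h s : ℝ) : ℕ := ⌊(s - t₀) / h⌋₊

/-- The integral from `t₀` to `s`, rounded down to the grid `t₀ + h ℕ`, of the step function with
values `v k`. -/
noncomputable def stepSum (t₀ h : ℝ) (v : ℕ → E) (s : ℝ) : E :=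
  h • ∑ k ∈ Finset.range (gridIndex t₀ h s), v k

lemma gridIndex_mono {t₀ h s s' : ℝ} (hh : 0 < h) (hs : s ≤ s') :
    gridIndex t₀ h s ≤ gridIndex t₀ h s' :=
  Nat.floor_mono (by gcongr)

lemma gridIndex_self (t₀ h : ℝ) : gridIndex t₀ h t₀ = 0 := by simp [gridIndex]

lemma gridIndex_mul_le {t₀ h s : ℝ} (hh : 0 < h) (hs : t₀ ≤ s) :
    gridIndex t₀ h s * h ≤ s - t₀ := by
  rw [← le_div_iff₀ hh]
  exact Nat.floor_le (div_nonneg (by linarith) hh.le)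

lemma lt_gridIndex_mul {t₀ h s : ℝ} (hh : 0 < h) :
    s - t₀ < (gridIndex t₀ h s + 1) * h := by
  rw [← div_lt_iff₀ hh]
  exact Nat.lt_floor_add_one _

lemma gridIndex_sub_mul_le {t₀ h s s' : ℝ} (hh : 0 < h) (hs : s ≤ s') :
    ((gridIndex t₀ h s' : ℝ) - gridIndex t₀ h s) * h ≤ s' - s + h := by
  rcases le_total t₀ s' with h0 | h0
  · have h1 := gridIndex_mul_le hh h0
    have h2 := lt_gridIndex_mul (t₀ := t₀) (s := s) hh
    linarith
  · have h1 : gridIndex t₀ h s' = 0 :=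
      Nat.floor_of_nonpos (div_nonpos_of_nonpos_of_nonneg (by linarith) hh.le)
    have h2 : (0 : ℝ) ≤ gridIndex t₀ h s * h := by positivity
    rw [h1]
    push_cast
    linarith

lemma stepSum_sub {t₀ h s s' : ℝ} (hh : 0 < h) (hs : s ≤ s') (v : ℕ → E) :
    stepSum t₀ h v s' - stepSum t₀ h v s =
      h • ∑ k ∈ Finset.Ico (gridIndex t₀ h s) (gridIndex t₀ h s'), v k := by
  rw [stepSum, stepSum, ← smul_sub, Finset.sum_Ico_eq_sub _ (gridIndex_mono hh hs)]

lemma norm_stepSum_sub_le {t₀ h s s' B : ℝ} (hh : 0 < h) (hs : s ≤ s') {v : ℕ → E}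
    (hv : ∀ k, ‖v k‖ ≤ B) :
    ‖stepSum t₀ h v s' - stepSum t₀ h v s‖ ≤ B * (s' - s + h) := by
  have hB : 0 ≤ B := (norm_nonneg _).trans (hv 0)
  rw [stepSum_sub hh hs, norm_smul, Real.norm_of_nonneg hh.le]
  have h1 := norm_sum_le_of_le (Finset.Ico (gridIndex t₀ h s) (gridIndex t₀ h s'))
    (fun k _ => hv k)
  rw [Finset.sum_const, Nat.card_Ico, nsmul_eq_mul, Nat.cast_sub (gridIndex_mono hh hs)] at h1
  have h2 := gridIndex_sub_mul_le (t₀ := t₀) hh hs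
  calc _ ≤ h * (((gridIndex t₀ h s' : ℝ) - gridIndex t₀ h s) * B) := by gcongr
    _ = B * (((gridIndex t₀ h s' : ℝ) - gridIndex t₀ h s) * h) := by ring
    _ ≤ _ := by gcongr

lemma tendsto_mesh : Tendsto (fun N : ℕ => ((N : ℝ) + 1)⁻¹) (hyperfilter ℕ) (𝓝 0) := by
  have : Tendsto (fun N : ℕ => ((N : ℝ) + 1)⁻¹) atTop (𝓝 0) := by
    simpa using tendsto_one_div_add_atTop_nhds_zero_nat (𝕜 := ℝ)
  exact this.mono_left Nat.hyperfilter_le_atTop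

/-- Uniformly bounded step functions have, along an ultrafilter, primitives converging to a
Lipschitz function. -/
lemma exists_lipschitz_limit [FiniteDimensional ℝ E] {t₀ : ℝ} {B : NNReal} {v : ℕ → ℕ → E}
    (hv : ∀ N k, ‖v N k‖ ≤ B) :
    ∃ V : ℝ → E, LipschitzWith B V ∧ V t₀ = 0 ∧
      ∀ s, Tendsto (fun N : ℕ => stepSum t₀ ((N : ℝ) + 1)⁻¹ (v N) s) (hyperfilter ℕ)
        (𝓝 (V s)) := by
  have := FiniteDimensional.proper_real E
  have hzero : ∀ N : ℕ, stepSum t₀ ((N : ℝ) + 1)⁻¹ (v N) t₀ = 0 := fun N => by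
    simp [stepSum, gridIndex_self]
  have hdiff : ∀ (N : ℕ) (s s' : ℝ), ‖stepSum t₀ ((N : ℝ) + 1)⁻¹ (v N) s' -
      stepSum t₀ ((N : ℝ) + 1)⁻¹ (v N) s‖ ≤ B * (|s' - s| + ((N : ℝ) + 1)⁻¹) := by
    intro N s s'
    rcases le_total s s' with h | h
    · rw [abs_of_nonneg (by linarith)]
      exact norm_stepSum_sub_le (by positivity) h (hv N)
    · rw [abs_sub_comm, abs_of_nonneg (by linarith), norm_sub_rev]
      exact norm_stepSum_sub_le (by positivity) h (hv N)
  have hlim : ∀ s, ∃ y, Tendsto (fun N : ℕ => stepSum t₀ ((N : ℝ) + 1)⁻¹ (v N) s)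
      (hyperfilter ℕ) (𝓝 y) := by
    intro s
    have hmem : ∀ N : ℕ, stepSum t₀ ((N : ℝ) + 1)⁻¹ (v N) s ∈
        Metric.closedBall (0 : E) (B * (|s - t₀| + 1)) := by
      intro N
      rw [mem_closedBall_zero_iff]
      have h1 := hdiff N t₀ s
      rw [hzero, sub_zero] at h1
      have h2 : ((N : ℝ) + 1)⁻¹ ≤ 1 := inv_le_one_of_one_le₀ (by
        have : (0 : ℝ) ≤ N := N.cast_nonneg
        linarith)
      refine h1.trans ?_
      gcongr
    obtain ⟨y, -, hy⟩ := (isCompact_closedBall (0 : E) (B * (|s - t₀| + 1))).ultrafilter_le_nhds'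
      ((hyperfilter ℕ).map (fun N : ℕ => stepSum t₀ ((N : ℝ) + 1)⁻¹ (v N) s))
      (Filter.mem_map.2 (Eventually.of_forall hmem))
    exact ⟨y, hy⟩
  choose V hV using hlim
  refine ⟨V, LipschitzWith.of_dist_le_mul fun s s' => ?_, ?_, hV⟩
  · rw [dist_eq_norm, Real.dist_eq]
    have h1 := ((hV s).sub (hV s')).norm
    have h2 : Tendsto (fun N : ℕ => (B : ℝ) * (|s - s'| + ((N : ℝ) + 1)⁻¹)) (hyperfilter ℕ)
        (𝓝 (B * (|s - s'| + 0))) := (tendsto_mesh.const_add _).const_mul _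
    rw [add_zero] at h2
    exact le_of_tendsto_of_tendsto' h1 h2 fun N => hdiff N s' s
  · refine tendsto_nhds_unique (hV t₀) ?_
    simp [hzero]

/-- A bound on the values of step functions passes to the increments of the limit of their
primitives. -/
lemma increment_le_of_tendsto {t₀ s τ : ℝ} (hs : t₀ ≤ s) (hτ : 0 < τ) {v : ℕ → ℕ → E} {V : ℝ → E}
    (hV : ∀ s, Tendsto (fun N : ℕ => stepSum t₀ ((N : ℝ) + 1)⁻¹ (v N) s) (hyperfilter ℕ)
      (𝓝 (V s)))
    (f : E →L[ℝ] ℝ) {φ : ℝ → ℝ} (hφ : Continuous φ) {e : ℕ → ℝ}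
    (he : Tendsto e (hyperfilter ℕ) (𝓝 0))
    (hv : ∀ N k : ℕ, gridIndex t₀ ((N : ℝ) + 1)⁻¹ s ≤ k →
      k < gridIndex t₀ ((N : ℝ) + 1)⁻¹ (s + τ) → f (v N k) ≤ φ (τ + ((N : ℝ) + 1)⁻¹ + e N)) :
    f (V (s + τ) - V s) ≤ τ * φ τ := by
  have h1 : Tendsto (fun N : ℕ => f (stepSum t₀ ((N : ℝ) + 1)⁻¹ (v N) (s + τ) -
      stepSum t₀ ((N : ℝ) + 1)⁻¹ (v N) s)) (hyperfilter ℕ) (𝓝 (f (V (s + τ) - V s))) :=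
    (f.continuous.tendsto _).comp ((hV _).sub (hV _))
  have h2 : Tendsto (fun N : ℕ => ((gridIndex t₀ ((N : ℝ) + 1)⁻¹ (s + τ) : ℝ) -
      gridIndex t₀ ((N : ℝ) + 1)⁻¹ s) * ((N : ℝ) + 1)⁻¹) (hyperfilter ℕ) (𝓝 τ) := by
    have hl : Tendsto (fun N : ℕ => τ - ((N : ℝ) + 1)⁻¹) (hyperfilter ℕ) (𝓝 τ) := by
      simpa using tendsto_mesh.const_sub τ
    have hu : Tendsto (fun N : ℕ => τ + ((N : ℝ) + 1)⁻¹) (hyperfilter ℕ) (𝓝 τ) := by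
      simpa using tendsto_mesh.const_add τ
    refine tendsto_of_tendsto_of_tendsto_of_le_of_le hl hu (fun N => ?_) (fun N => ?_)
    · have hN : (0 : ℝ) < ((N : ℝ) + 1)⁻¹ := by positivity
      have h3 := gridIndex_mul_le hN hs
      have h4 := lt_gridIndex_mul (t₀ := t₀) (s := s + τ) hN
      simp only
      linarith
    · have h3 := gridIndex_sub_mul_le (t₀ := t₀) (s := s) (s' := s + τ)
        (h := ((N : ℝ) + 1)⁻¹) (by positivity) (by linarith)
      simpa using h3
  have h3 : Tendsto (fun N : ℕ => φ (τ + ((N : ℝ) + 1)⁻¹ + e N)) (hyperfilter ℕ) (𝓝 (φ τ)) := by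
    have : Tendsto (fun N : ℕ => τ + ((N : ℝ) + 1)⁻¹ + e N) (hyperfilter ℕ) (𝓝 (τ + 0 + 0)) :=
      (tendsto_mesh.const_add _).add he
    rw [add_zero, add_zero] at this
    exact (hφ.tendsto _).comp this
  refine le_of_tendsto_of_tendsto' h1 (h2.mul h3) fun N => ?_
  have hN : (0 : ℝ) < ((N : ℝ) + 1)⁻¹ := by positivity
  rw [stepSum_sub hN (by linarith), map_smul, map_sum, smul_eq_mul]
  have h4 := Finset.sum_le_card_nsmul
    (Finset.Ico (gridIndex t₀ ((N : ℝ) + 1)⁻¹ s) (gridIndex t₀ ((N : ℝ) + 1)⁻¹ (s + τ)))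
    (fun k => f (v N k)) _ (fun k hk => hv N k (Finset.mem_Ico.1 hk).1 (Finset.mem_Ico.1 hk).2)
  rw [Nat.card_Ico, nsmul_eq_mul, Nat.cast_sub (gridIndex_mono hN (by linarith))] at h4
  calc _ ≤ ((N : ℝ) + 1)⁻¹ * _ := mul_le_mul_of_nonneg_left h4 hN.le
    _ = _ := by ring

lemma apply_deriv_le_of_increment_le {F : Type*} [NormedAddCommGroup F] [NormedSpace ℝ F]
    {V : ℝ → F} {V' : F} {s : ℝ} (hV : HasDerivAt V V' s) (f : F →L[ℝ] ℝ) {φ : ℝ → ℝ}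
    (hφ : Continuous φ)
    (h : ∀ τ > 0, f (V (s + τ) - V s) ≤ τ * φ τ) : f V' ≤ φ 0 := by
  have h1 : Tendsto (fun τ : ℝ => f (τ⁻¹ • (V (s + τ) - V s))) (𝓝[>] 0) (𝓝 (f V')) :=
    (f.continuous.tendsto _).comp hV.tendsto_slope_zero_right
  have h2 : Tendsto φ (𝓝[>] 0) (𝓝 (φ 0)) := (hφ.tendsto 0).mono_left nhdsWithin_le_nhds
  refine le_of_tendsto_of_tendsto h1 h2 ?_
  filter_upwards [self_mem_nhdsWithin] with τ hτ
  rw [map_smul, smul_eq_mul, inv_mul_le_iff₀ hτ]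
  exact h τ hτ

end PolygonalLimits

section Lipschitz

/-- The fundamental theorem of calculus for Lipschitz functions with values in a
finite-dimensional space. -/
lemma LipschitzWith.integral_deriv_eq_sub [FiniteDimensional ℝ E] {f : ℝ → E} {B : NNReal}
    (hf : LipschitzWith B f) (a b : ℝ) :
    IntervalIntegrable (deriv f) volume a b ∧ ∫ s in a..b, deriv f s = f b - f a := by
  have := FiniteDimensional.proper_real E
  have hbound : ∀ s, ‖deriv f s‖ ≤ B := fun s => norm_deriv_le_of_lipschitz hf
  have hint : ∀ c d, IntervalIntegrable (deriv f) volume c d := by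
    intro c d
    refine (intervalIntegrable_const (c := (B : ℝ))).mono_fun
      (stronglyMeasurable_deriv f).aestronglyMeasurable (Filter.Eventually.of_forall fun s => ?_)
    simpa using hbound s
  refine ⟨hint a b, ?_⟩
  have hlip : LipschitzWith B (fun t => ∫ s in a..t, deriv f s) := by
    refine LipschitzWith.of_dist_le_mul fun t u => ?_
    rw [dist_eq_norm, intervalIntegral.integral_interval_sub_left (hint a t) (hint a u),
      Real.dist_eq]
    exact intervalIntegral.norm_integral_le_of_norm_le_const fun s _ => hbound s
  have hac : AbsolutelyContinuousOnInterval (fun t => f t - ∫ s in a..t, deriv f s) a b :=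
    ((hf.sub hlip).lipschitzOnWith (s := uIcc a b)).absolutelyContinuousOnInterval
  have hd : ∀ᵐ t, t ∈ uIcc a b →
      HasDerivAt (fun t => f t - ∫ s in a..t, deriv f s) 0 t := by
    filter_upwards [hf.ae_differentiableAt_real, (hint a b).ae_hasDerivAt_integral] with t h1 h2 h3
    simpa using h1.hasDerivAt.fun_sub (h2 h3 a left_mem_uIcc)
  obtain ⟨c, hc⟩ := hac.const_of_ae_hasDerivAt_zero hd
  have ha := hc a left_mem_uIcc
  have hb := hc b right_mem_uIcc
  simp only [intervalIntegral.integral_same, sub_zero] at ha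
  rw [← ha] at hb
  rw [← hb]
  abel

end Lipschitz

section Existence

variable {r L_C M L_G : ℝ} {C : ℝ → Set E} {G : ℝ → E → Set E}

/-- Limits of the catching-up algorithm, described through integrated inequalities. The limit
trajectory is `x₀ + (w - z)`, where `w` and `z` are the primitives of the perturbation and of the
normal reaction. -/
lemma exists_catching_up_limit [FiniteDimensional ℝ E] (hr : 0 < r) (hC : HypC r L_C C)
    (hG : HypG M L_G G) {t₀ : ℝ} (ht₀ : 0 ≤ t₀) {x₀ g₀ : E} (hx₀ : x₀ ∈ C t₀)
    (hg₀ : g₀ ∈ G t₀ x₀) :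
    ∃ w z : ℝ → E, LipschitzWith M.toNNReal w ∧ LipschitzWith (L_C + M).toNNReal z ∧
      w t₀ = 0 ∧ z t₀ = 0 ∧
      (∀ s, t₀ ≤ s → x₀ + (w s - z s) ∈ C s) ∧
      (∀ s, t₀ ≤ s → ∀ τ > 0, ∀ (f : E →L[ℝ] ℝ) (σ : ℝ),
        (∀ g ∈ G s (x₀ + (w s - z s)), f g ≤ σ) →
        f (w (s + τ) - w s) ≤ τ * (σ + ‖f‖ * (L_G * (1 + (L_C + 2 * M)) * τ))) ∧
      (∀ s, t₀ ≤ s → ∀ τ > 0, ∀ c ∈ C s,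
        ⟪c - (x₀ + (w s - z s)), z (s + τ) - z s⟫ ≤
          τ * ((L_C + M) * ((L_C + (1 + (L_C + 2 * M))) * τ) + (L_C + M) / (2 * r) *
            (‖c - (x₀ + (w s - z s))‖ + (L_C + (1 + (L_C + 2 * M))) * τ) ^ 2)) ∧
      (∀ τ > 0, ∀ f : E →L[ℝ] ℝ,
        f (w (t₀ + τ)) ≤ τ * (f g₀ + ‖f‖ * (L_G * (1 + (L_C + 2 * M)) * τ))) := by
  have hLC := hC.lipschitz_nonneg
  have hM := hG.bound_nonneg
  have hLG := hG.lipschitz_nonneg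
  have hpos : ∀ N : ℕ, (0 : ℝ) < ((N : ℝ) + 1)⁻¹ := fun N => by positivity
  choose X g ξ hX0 hX using fun N : ℕ => exists_catching_up hC hG ht₀ (hpos N) hx₀ hg₀
  choose hXC hgG hgg₀ hξ hξb hXs using hX
  have hgb : ∀ N k, ‖g N k‖ ≤ M.toNNReal := fun N k => by
    rw [Real.coe_toNNReal _ hM]; exact hG.bounded _ _ _ (hgG N k)
  have hξb' : ∀ N k, ‖ξ N k‖ ≤ (L_C + M).toNNReal := fun N k => by
    rw [Real.coe_toNNReal _ (by linarith)]; exact hξb N k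
  obtain ⟨w, hwL, hw0, hw⟩ := exists_lipschitz_limit (t₀ := t₀) hgb
  obtain ⟨z, hzL, hz0, hz⟩ := exists_lipschitz_limit (t₀ := t₀) hξb'
  set B : ℝ := L_C + 2 * M with hB
  have hB0 : 0 ≤ B := by linarith
  have hsum : ∀ N k, X N k = x₀ + ((((N : ℝ) + 1)⁻¹ • ∑ j ∈ Finset.range k, g N j) -
      ((N : ℝ) + 1)⁻¹ • ∑ j ∈ Finset.range k, ξ N j) := by
    intro N k
    induction k with
    | zero => simp [hX0]
    | succ k ih =>
      rw [hXs, Finset.sum_range_succ, Finset.sum_range_succ, smul_add, smul_add, ih, smul_sub]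
      abel
  have hXlim : ∀ s, Tendsto (fun N : ℕ => X N (gridIndex t₀ ((N : ℝ) + 1)⁻¹ s)) (hyperfilter ℕ)
      (𝓝 (x₀ + (w s - z s))) := by
    intro s
    simp only [hsum]
    exact ((hw s).sub (hz s)).const_add x₀
  have helim : ∀ s, Tendsto (fun N : ℕ => ‖X N (gridIndex t₀ ((N : ℝ) + 1)⁻¹ s) -
      (x₀ + (w s - z s))‖) (hyperfilter ℕ) (𝓝 0) := fun s => by
    simpa using ((hXlim s).sub_const (x₀ + (w s - z s))).norm
  have hXstep : ∀ N i m : ℕ, ‖X N (i + m) - X N i‖ ≤ B * (m * ((N : ℝ) + 1)⁻¹) := by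
    intro N i m
    induction m with
    | zero => simp
    | succ m ih =>
      rw [← add_assoc, hXs, add_sub_right_comm]
      refine (norm_add_le _ _).trans ?_
      have h1 : ‖((N : ℝ) + 1)⁻¹ • (g N (i + m) - ξ N (i + m))‖ ≤ ((N : ℝ) + 1)⁻¹ * B := by
        rw [norm_smul, Real.norm_of_nonneg (hpos N).le]
        have h2 := norm_sub_le (g N (i + m)) (ξ N (i + m))
        have h3 := hG.bounded _ _ _ (hgG N (i + m))
        have h4 := hξb N (i + m)
        have h5 : ‖g N (i + m) - ξ N (i + m)‖ ≤ B := by linarith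
        gcongr
      push_cast
      linarith
  have htime : ∀ s, t₀ ≤ s → ∀ τ > 0, ∀ N j : ℕ, gridIndex t₀ ((N : ℝ) + 1)⁻¹ s ≤ j →
      j ≤ gridIndex t₀ ((N : ℝ) + 1)⁻¹ (s + τ) →
      |t₀ + j * ((N : ℝ) + 1)⁻¹ - s| ≤ τ + ((N : ℝ) + 1)⁻¹ := by
    intro s hs τ hτ N j h1 h2
    have h3 := gridIndex_mul_le (hpos N) (show t₀ ≤ s + τ by linarith)
    have h4 := lt_gridIndex_mul (t₀ := t₀) (s := s) (hpos N)
    have h5 : (j : ℝ) * ((N : ℝ) + 1)⁻¹ ≤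
        gridIndex t₀ ((N : ℝ) + 1)⁻¹ (s + τ) * ((N : ℝ) + 1)⁻¹ := by gcongr
    have h6 : (gridIndex t₀ ((N : ℝ) + 1)⁻¹ s : ℝ) * ((N : ℝ) + 1)⁻¹ ≤
        j * ((N : ℝ) + 1)⁻¹ := by gcongr
    have h7 := hpos N
    rw [abs_le]
    constructor <;> linarith
  have hspace : ∀ s, t₀ ≤ s → ∀ τ > 0, ∀ N j : ℕ, gridIndex t₀ ((N : ℝ) + 1)⁻¹ s ≤ j →
      j ≤ gridIndex t₀ ((N : ℝ) + 1)⁻¹ (s + τ) →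
      ‖X N j - (x₀ + (w s - z s))‖ ≤ B * (τ + ((N : ℝ) + 1)⁻¹) +
        ‖X N (gridIndex t₀ ((N : ℝ) + 1)⁻¹ s) - (x₀ + (w s - z s))‖ := by
    intro s hs τ hτ N j h1 h2
    refine (norm_sub_le_norm_sub_add_norm_sub _ (X N (gridIndex t₀ ((N : ℝ) + 1)⁻¹ s)) _).trans ?_
    gcongr
    obtain ⟨m, rfl⟩ := Nat.exists_eq_add_of_le h1
    refine (hXstep N _ m).trans ?_
    gcongr
    have h3 := gridIndex_sub_mul_le (t₀ := t₀) (s := s) (s' := s + τ) (hpos N) (by linarith)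
    have h4 : ((gridIndex t₀ ((N : ℝ) + 1)⁻¹ s + m : ℕ) : ℝ) ≤
      gridIndex t₀ ((N : ℝ) + 1)⁻¹ (s + τ) := by exact_mod_cast h2
    push_cast at h4
    calc (m : ℝ) * ((N : ℝ) + 1)⁻¹ ≤ ((gridIndex t₀ ((N : ℝ) + 1)⁻¹ (s + τ) : ℝ) -
        gridIndex t₀ ((N : ℝ) + 1)⁻¹ s) * ((N : ℝ) + 1)⁻¹ := by
          gcongr
          linarith
      _ ≤ _ := by linarith
  refine ⟨w, z, hwL, hzL, hw0, hz0, ?_, ?_, ?_, ?_⟩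
  · intro s hs
    have hs0 : 0 ≤ s := ht₀.trans hs
    rw [(hC.isCompact s hs0).isClosed.mem_iff_infDist_zero (hC.nonempty s hs0)]
    refine le_antisymm ?_ infDist_nonneg
    have h1 := ((continuous_infDist_pt (C s)).tendsto _).comp (hXlim s)
    have h2 : Tendsto (fun N : ℕ => L_C * ((N : ℝ) + 1)⁻¹) (hyperfilter ℕ) (𝓝 0) := by
      simpa using tendsto_mesh.const_mul L_C
    refine le_of_tendsto_of_tendsto' h1 h2 fun N => ?_
    obtain ⟨y, hy, hyy⟩ := hC.exists_near (t := s) (by have := hpos N; positivity) hs0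
      (hXC N (gridIndex t₀ ((N : ℝ) + 1)⁻¹ s))
    refine (infDist_le_dist_of_mem hy).trans ?_
    rw [dist_eq_norm]
    refine hyy.trans ?_
    gcongr
    have h3 := gridIndex_mul_le (hpos N) hs
    have h4 := lt_gridIndex_mul (t₀ := t₀) (s := s) (hpos N)
    have h5 := hpos N
    rw [abs_le]
    constructor <;> linarith
  · intro s hs τ hτ f σ hf
    refine increment_le_of_tendsto hs hτ hw f
      (φ := fun d => σ + ‖f‖ * (L_G * (1 + B) * d)) (by fun_prop) (helim s) ?_
    intro N k h1 h2
    obtain ⟨g', hg', hgg'⟩ := hG.exists_near (t := s) (y := x₀ + (w s - z s)) (hgG N k)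
    have h3 := htime s hs τ hτ N k h1 h2.le
    have h4 := hspace s hs τ hτ N k h1 h2.le
    set e := ‖X N (gridIndex t₀ ((N : ℝ) + 1)⁻¹ s) - (x₀ + (w s - z s))‖
    have he : 0 ≤ e := norm_nonneg _
    have h5 : f (g N k) = f g' + f (g N k - g') := by rw [← map_add]; congr 1; abel
    have h6 : f (g N k - g') ≤ ‖f‖ * ‖g N k - g'‖ :=
      (le_abs_self _).trans (f.le_opNorm _)
    rw [h5]
    refine add_le_add (hf g' hg') (h6.trans ?_)
    gcongr
    refine hgg'.trans ?_
    rw [mul_assoc]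
    gcongr
    have := mul_nonneg hB0 he
    linarith
  · intro s hs τ hτ c hc
    refine increment_le_of_tendsto hs hτ hz (innerSL ℝ (c - (x₀ + (w s - z s))))
      (φ := fun d => (L_C + M) * ((L_C + (1 + B)) * d) + (L_C + M) / (2 * r) *
            (‖c - (x₀ + (w s - z s))‖ + (L_C + (1 + B)) * d) ^ 2) (by fun_prop) (helim s) ?_
    intro N k h1 h2
    have h3 := htime s hs τ hτ N (k + 1) (by omega) h2
    have h4 := hspace s hs τ hτ N (k + 1) (by omega) h2
    set e := ‖X N (gridIndex t₀ ((N : ℝ) + 1)⁻¹ s) - (x₀ + (w s - z s))‖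
    have he : 0 ≤ e := norm_nonneg _
    rw [innerSL_apply_apply, real_inner_comm]
    push_cast at h3
    refine hC.inner_le hr (by have := hpos N; positivity) (ht₀.trans hs) (hξ N k) (hξb N k) hc ?_
    have h5 := mul_le_mul_of_nonneg_left h3 hLC
    have := mul_nonneg hB0 he
    have := mul_nonneg hLC he
    have := hpos N
    linarith
  · intro τ hτ f
    have key := increment_le_of_tendsto le_rfl hτ hw f
      (φ := fun d => f g₀ + ‖f‖ * (L_G * (1 + B) * d)) (by fun_prop) (helim t₀) ?_
    · simpa [hw0] using key
    intro N k h1 h2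
    have h3 := htime t₀ le_rfl τ hτ N k h1 h2.le
    have h4 := hspace t₀ le_rfl τ hτ N k h1 h2.le
    set e := ‖X N (gridIndex t₀ ((N : ℝ) + 1)⁻¹ t₀) - (x₀ + (w t₀ - z t₀))‖
    have he : 0 ≤ e := norm_nonneg _
    rw [hw0, hz0, sub_zero, add_zero] at h4
    rw [add_sub_cancel_left] at h3
    have h5 : f (g N k) = f g₀ + f (g N k - g₀) := by rw [← map_add]; congr 1; abel
    have h6 : f (g N k - g₀) ≤ ‖f‖ * ‖g N k - g₀‖ :=
      (le_abs_self _).trans (f.le_opNorm _)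
    rw [h5]
    gcongr
    refine h6.trans ?_
    gcongr
    refine (hgg₀ N k).trans ?_
    rw [mul_assoc]
    gcongr
    have := mul_nonneg hB0 he
    have := (le_abs_self _).trans h3
    linarith

lemma isSweepingSol_of_increment_le [FiniteDimensional ℝ E] (hr : 0 < r) (hG : HypG M L_G G)
    {t₀ T Λ D A : ℝ} (hΛ : 0 ≤ Λ) {x₀ : E} {w z : ℝ → E} {Bw Bz : NNReal}
    (hwL : LipschitzWith Bw w) (hzL : LipschitzWith Bz z)
    (hw0 : w t₀ = 0) (hz0 : z t₀ = 0) (hxC : ∀ s, t₀ ≤ s → x₀ + (w s - z s) ∈ C s)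
    (hw : ∀ s, t₀ ≤ s → ∀ τ > 0, ∀ (f : E →L[ℝ] ℝ) (σ : ℝ),
      (∀ g ∈ G s (x₀ + (w s - z s)), f g ≤ σ) →
      f (w (s + τ) - w s) ≤ τ * (σ + ‖f‖ * (A * τ)))
    (hz : ∀ s, t₀ ≤ s → ∀ τ > 0, ∀ c ∈ C s,
      ⟪c - (x₀ + (w s - z s)), z (s + τ) - z s⟫ ≤
        τ * (Λ * (D * τ) + Λ / (2 * r) * (‖c - (x₀ + (w s - z s))‖ + D * τ) ^ 2)) :
    IsSweepingSol C G t₀ T (fun s => x₀ + (w s - z s)) := by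
  refine ⟨fun t ht => hxC t ht.1, fun s => deriv w s - deriv z s, ?_, ?_, ?_⟩
  · rcases le_total t₀ T with h | h
    · rw [integrableOn_Icc_iff_integrableOn_Ioc]
      exact (intervalIntegrable_iff_integrableOn_Ioc_of_le h).1
        ((hwL.integral_deriv_eq_sub t₀ T).1.sub (hzL.integral_deriv_eq_sub t₀ T).1)
    · rcases h.eq_or_lt with h | h
      · simp [h]
      · simp [Icc_eq_empty_of_lt h]
  · intro t _
    obtain ⟨hiw, hew⟩ := hwL.integral_deriv_eq_sub t₀ t
    obtain ⟨hiz, hez⟩ := hzL.integral_deriv_eq_sub t₀ t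
    simp only
    rw [intervalIntegral.integral_sub hiw hiz, hew, hez, hw0, hz0]
    simp
  · rw [ae_restrict_iff' measurableSet_Icc]
    filter_upwards [hwL.ae_differentiableAt_real, hzL.ae_differentiableAt_real] with s h1 h2 hs
    refine Set.mem_add.2 ⟨-deriv z s, ?_, deriv w s, ?_, neg_add_eq_sub _ _⟩
    · rw [Set.neg_mem_neg]
      refine ⟨hxC s hs.1, Λ / (2 * r), by positivity, fun c hc => ?_⟩
      have := apply_deriv_le_of_increment_le h2.hasDerivAt
        (innerSL ℝ (c - (x₀ + (w s - z s)))) (φ := fun τ => Λ * (D * τ) + Λ / (2 * r) *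
          (‖c - (x₀ + (w s - z s))‖ + D * τ) ^ 2) (by fun_prop) (fun τ hτ => hz s hs.1 τ hτ c hc)
      rw [innerSL_apply_apply, real_inner_comm] at this
      simpa using this
    · by_contra hcon
      obtain ⟨f, u, hfu, huf⟩ := geometric_hahn_banach_closed_point (hG.convex s _)
        (hG.isClosed s _) hcon
      have := apply_deriv_le_of_increment_le h1.hasDerivAt f (φ := fun τ => u + ‖f‖ * (A * τ))
        (by fun_prop) (fun τ hτ => hw s hs.1 τ hτ f u fun g hg => (hfu g hg).le)
      simp only [mul_zero, add_zero] at this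
      linarith

end Existence

section Necessity

variable {r L_C M L_G : ℝ} {C : ℝ → Set E} {G : ℝ → E → Set E}

/-- Pointwise inequality behind the necessity of the Hamiltonian condition: a solution leaving
`(t, x)` with perturbation close to `g` stays in the invariant set. -/
lemma exists_reaction_of_invariance [FiniteDimensional ℝ E] (hr : 0 < r) (hC : HypC r L_C C)
    (hG : HypG M L_G G) {K : Set E} {t : ℝ} (ht : 0 ≤ t) {x : E} (hx : x ∈ C t)
    (hinv : ∀ T > t, ∀ y : ℝ → E, IsSweepingSol C G t T y → y t = x → ∀ s ∈ Icc t T, y s ∈ K)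
    {p : ℝ × E} (hp : p ∈ proxNormalCone2 {q : ℝ × E | 0 ≤ q.1 ∧ q.2 ∈ C q.1 ∩ K} (t, x))
    {g : E} (hg : g ∈ G t x) :
    ∃ ξ ∈ proxNormalCone (C t) x, ‖ξ‖ ≤ L_C + M ∧ ⟪-ξ, p.2⟫ + (p.1 + ⟪g, p.2⟫) ≤ 0 := by
  have := FiniteDimensional.proper_real E
  have hLC := hC.lipschitz_nonneg
  have hM := hG.bound_nonneg
  have hΛ : 0 ≤ L_C + M := by linarith
  obtain ⟨w, z, hwL, hzL, hw0, hz0, hxC, hw, hz, hwg⟩ := exists_catching_up_limit hr hC hG ht hx hg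
  have hsol : IsSweepingSol C G t (t + 2) (fun s => x + (w s - z s)) :=
    isSweepingSol_of_increment_le hr hG hΛ hwL hzL hw0 hz0 hxC hw hz
  have hyK := hinv (t + 2) (by linarith) _ hsol (by simp [hw0, hz0])
  obtain ⟨-, σ, hσ, hpσ⟩ := hp
  set B : ℝ := M + (L_C + M) with hB
  have hzb : ∀ τ > 0, ‖z (t + τ)‖ ≤ (L_C + M) * τ := fun τ hτ => by
    have := hzL.dist_le_mul (t + τ) t
    rw [hz0, dist_zero_right, Real.coe_toNNReal _ hΛ, Real.dist_eq, add_sub_cancel_left,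
      abs_of_pos hτ] at this
    exact this
  have hwb : ∀ τ > 0, ‖w (t + τ)‖ ≤ M * τ := fun τ hτ => by
    have := hwL.dist_le_mul (t + τ) t
    rw [hw0, dist_zero_right, Real.coe_toNNReal _ hM, Real.dist_eq, add_sub_cancel_left,
      abs_of_pos hτ] at this
    exact this
  set τ : ℕ → ℝ := fun N => ((N : ℝ) + 1)⁻¹ with hτdef
  have hτ0 : ∀ N, 0 < τ N := fun N => by positivity
  have hτ1 : ∀ N, τ N ≤ 1 := fun N => inv_le_one_of_one_le₀ (by
    have : (0 : ℝ) ≤ N := N.cast_nonneg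
    linarith)
  have hmem : ∀ N, (τ N)⁻¹ • z (t + τ N) ∈ Metric.closedBall (0 : E) (L_C + M) := fun N => by
    rw [mem_closedBall_zero_iff, norm_smul, norm_inv, Real.norm_of_nonneg (hτ0 N).le,
      inv_mul_le_iff₀ (hτ0 N), mul_comm]
    exact hzb _ (hτ0 N)
  obtain ⟨ξ, hξmem, hξlim⟩ := (isCompact_closedBall (0 : E) (L_C + M)).ultrafilter_le_nhds'
    ((hyperfilter ℕ).map (fun N : ℕ => (τ N)⁻¹ • z (t + τ N)))
    (Filter.mem_map.2 (Eventually.of_forall hmem))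
  replace hξlim : Tendsto (fun N : ℕ => (τ N)⁻¹ • z (t + τ N)) (hyperfilter ℕ) (𝓝 ξ) := hξlim
  refine ⟨ξ, ⟨hx, (L_C + M) / (2 * r), by positivity, fun c hc => ?_⟩,
    mem_closedBall_zero_iff.1 hξmem, ?_⟩
  · set D := L_C + (1 + (L_C + 2 * M))
    have h1 : Tendsto (fun N : ℕ => ⟪c - x, (τ N)⁻¹ • z (t + τ N)⟫) (hyperfilter ℕ)
        (𝓝 ⟪c - x, ξ⟫) := tendsto_const_nhds.inner hξlim
    have h2 : Tendsto (fun N : ℕ => (L_C + M) * (D * τ N) +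
        (L_C + M) / (2 * r) * (‖c - x‖ + D * τ N) ^ 2) (hyperfilter ℕ)
        (𝓝 ((L_C + M) * (D * 0) + (L_C + M) / (2 * r) * (‖c - x‖ + D * 0) ^ 2)) :=
      ((by fun_prop : Continuous fun d : ℝ => (L_C + M) * (D * d) +
        (L_C + M) / (2 * r) * (‖c - x‖ + D * d) ^ 2).tendsto 0).comp tendsto_mesh
    have h3 := le_of_tendsto_of_tendsto' h1 h2 fun N => by
      have h4 := hz t le_rfl (τ N) (hτ0 N) c hc
      rw [hw0, hz0, sub_zero, sub_zero, add_zero] at h4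
      rw [real_inner_smul_right, inv_mul_le_iff₀ (hτ0 N)]
      exact h4
    rw [real_inner_comm]
    simpa using h3
  · set f : E →L[ℝ] ℝ := -innerSL ℝ p.2
    set A := L_G * (1 + (L_C + 2 * M))
    have h1 : Tendsto (fun N : ℕ => p.1 + ⟪p.2, g⟫ - ⟪p.2, (τ N)⁻¹ • z (t + τ N)⟫)
        (hyperfilter ℕ) (𝓝 (p.1 + ⟪p.2, g⟫ - ⟪p.2, ξ⟫)) :=
      (tendsto_const_nhds.inner hξlim).const_sub _
    have h2 : Tendsto (fun N : ℕ => (σ * (1 + B ^ 2) + ‖f‖ * A) * τ N) (hyperfilter ℕ)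
        (𝓝 0) := by simpa using tendsto_mesh.const_mul (σ * (1 + B ^ 2) + ‖f‖ * A)
    have h3 := le_of_tendsto_of_tendsto' h1 h2 fun N => by
      have hτN := hτ0 N
      have hxt : t ≤ t + τ N := by linarith
      have h4 := hpσ (t + τ N, x + (w (t + τ N) - z (t + τ N)))
        ⟨ht.trans hxt, hxC _ hxt, hyK _ ⟨hxt, by have := hτ1 N; linarith⟩⟩
      simp only [add_sub_cancel_left, inner_sub_right] at h4
      have h5 : ‖w (t + τ N) - z (t + τ N)‖ ^ 2 ≤ (B * τ N) ^ 2 := by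
        gcongr
        refine (norm_sub_le _ _).trans ?_
        have := hzb _ hτN
        have := hwb _ hτN
        rw [hB]
        linarith
      have h6 : σ * (τ N ^ 2 + ‖w (t + τ N) - z (t + τ N)‖ ^ 2) ≤
          σ * (τ N ^ 2 + (B * τ N) ^ 2) := by gcongr
      have h7 := hwg (τ N) hτN f
      simp only [f, neg_apply, innerSL_apply_apply] at h7
      have h8 : τ N * (p.1 + ⟪p.2, g⟫) - ⟪p.2, z (t + τ N)⟫ ≤
          τ N * ((σ * (1 + B ^ 2) + ‖f‖ * A) * τ N) := by
        simp only [f]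
        linarith
      rw [real_inner_smul_right]
      refine le_of_mul_le_mul_left ?_ hτN
      rw [mul_sub, mul_inv_cancel_left₀ hτN.ne']
      exact h8
    rw [inner_neg_left, real_inner_comm p.2 ξ, real_inner_comm p.2 g]
    linarith

end Necessity

section Solutions

variable {r L_C M L_G : ℝ} {C : ℝ → Set E} {G : ℝ → E → Set E}

/-- The normal reaction along a trajectory is bounded by the speed of the constraint plus the norm
of the perturbation. -/
lemma norm_reaction_le (hr : 0 < r) (hC : HypC r L_C C) {t₀ s : ℝ} (ht₀ : 0 ≤ t₀) (hs : t₀ < s)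
    {x : ℝ → E} (hx : ∀ t ∈ Icc t₀ s, x t ∈ C t) {ξ g : E} (hξ : ξ ∈ proxNormalCone (C s) (x s))
    (hg : ‖g‖ ≤ M) (hd : HasDerivAt x (g - ξ) s) : ‖ξ‖ ≤ L_C + M := by
  set q : ℝ → E := fun τ => τ⁻¹ • (x (s - τ) - x s) with hq
  have hdq : Tendsto q (𝓝[>] 0) (𝓝 (-(g - ξ))) := by
    have h1 : HasDerivAt (fun τ => x (s - τ)) (-(g - ξ)) 0 := by
      have h2 : HasDerivAt (fun τ : ℝ => s - τ) (-1) 0 := by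
        simpa using (hasDerivAt_id (0 : ℝ)).const_sub s
      have h3 : HasDerivAt x (g - ξ) (s - 0) := by simpa using hd
      simpa using (show HasDerivAt (fun τ => x (s - τ)) _ 0 from h3.scomp (0 : ℝ) h2)
    simpa using h1.tendsto_slope_zero_right
  have hτ : Tendsto (fun τ : ℝ => τ) (𝓝[>] 0) (𝓝 0) := tendsto_id.mono_left nhdsWithin_le_nhds
  have h1 : Tendsto (fun τ => ⟪ξ, q τ⟫) (𝓝[>] 0) (𝓝 ⟪ξ, -(g - ξ)⟫) :=
    tendsto_const_nhds.inner hdq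
  have h2 : Tendsto (fun τ => ‖ξ‖ * L_C + ‖ξ‖ / (2 * r) * (τ * (‖q τ‖ + L_C) ^ 2)) (𝓝[>] 0)
      (𝓝 (‖ξ‖ * L_C + ‖ξ‖ / (2 * r) * (0 * (‖-(g - ξ)‖ + L_C) ^ 2))) :=
    ((hτ.mul ((hdq.norm.add_const L_C).pow 2)).const_mul _).const_add _
  have h3 := le_of_tendsto_of_tendsto h1 h2 (by
    filter_upwards [Ioo_mem_nhdsGT (sub_pos.2 hs)] with τ hτ
    have hsτ : s - τ ∈ Icc t₀ s := ⟨by linarith [hτ.2], by linarith [hτ.1]⟩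
    have h4 := hC.inner_le hr (by linarith) (by linarith [hτ.2]) hξ le_rfl (hx _ hsτ) (a' := x s)
      (δ := L_C * τ) (by simp [abs_of_pos hτ.1])
    have h5 : x (s - τ) - x s = τ • q τ := by rw [hq]; simp [smul_inv_smul₀ hτ.1.ne']
    rw [h5, real_inner_smul_right, norm_smul, Real.norm_of_nonneg hτ.1.le] at h4
    refine le_of_mul_le_mul_left (h4.trans_eq ?_) hτ.1
    ring)
  rw [inner_neg_right, inner_sub_right, real_inner_self_eq_norm_sq] at h3
  have h6 : ⟪ξ, g⟫ ≤ ‖ξ‖ * M := (real_inner_le_norm _ _).trans (by gcongr)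
  rcases (norm_nonneg ξ).eq_or_lt with h0 | h0
  · rw [← h0]
    have := hC.lipschitz_nonneg
    have := (norm_nonneg g).trans hg
    linarith
  · refine le_of_mul_le_mul_left ?_ h0
    linarith

lemma IsSweepingSol.exists_bounded_reaction [FiniteDimensional ℝ E] (hr : 0 < r)
    (hC : HypC r L_C C) (hG : HypG M L_G G) {t₀ T : ℝ} (ht₀ : 0 ≤ t₀) (hT : t₀ ≤ T) {x : ℝ → E}
    (hx : IsSweepingSol C G t₀ T x) :
    ∃ x' : ℝ → E, (∀ a ∈ Icc t₀ T, ∀ b ∈ Icc t₀ T,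
        IntervalIntegrable x' volume a b ∧ x b - x a = ∫ s in a..b, x' s) ∧
      ∀ᵐ s, s ∈ Icc t₀ T → ∃ ξ ∈ proxNormalCone (C s) (x s), ∃ g ∈ G s (x s),
        ‖ξ‖ ≤ L_C + M ∧ x' s = g - ξ := by
  have := FiniteDimensional.proper_real E
  obtain ⟨hxC, x', hint, hxint, hincl⟩ := hx
  have hI : ∀ a ∈ Icc t₀ T, ∀ b ∈ Icc t₀ T, IntervalIntegrable x' volume a b := fun a ha b hb =>
    (hint.mono_set (uIcc_subset_Icc ha hb)).intervalIntegrable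
  refine ⟨x', fun a ha b hb => ⟨hI a ha b hb, ?_⟩, ?_⟩
  · have ht : t₀ ∈ Icc t₀ T := left_mem_Icc.2 hT
    rw [hxint a ha, hxint b hb, add_sub_add_left_eq_sub,
      intervalIntegral.integral_interval_sub_left (hI _ ht _ hb) (hI _ ht _ ha)]
  · rw [ae_restrict_iff' measurableSet_Icc] at hincl
    have hne : ∀ c : ℝ, ∀ᵐ s : ℝ, s ≠ c := fun c => by simp [ae_iff, measure_singleton]
    filter_upwards [hincl,
      (hI t₀ (left_mem_Icc.2 hT) T (right_mem_Icc.2 hT)).ae_hasDerivAt_integral, hne t₀, hne T] with s h1 h2 h3 h4 hs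
    obtain ⟨ζ, hζ, g, hg, hsum⟩ := Set.mem_add.1 (h1 hs)
    have hx's : x' s = g - -ζ := by rw [← hsum]; abel
    refine ⟨-ζ, hζ, g, hg, ?_, hx's⟩
    have hs1 : t₀ < s := lt_of_le_of_ne hs.1 (Ne.symm h3)
    have hs2 : s < T := lt_of_le_of_ne hs.2 h4
    refine norm_reaction_le hr hC ht₀ hs1 (fun t ht => hxC t ⟨ht.1, ht.2.trans hs.2⟩) hζ
      (hG.bounded _ _ _ hg) ?_
    rw [← hx's]
    have h5 := (h2 (by rwa [uIcc_of_le hT]) t₀ left_mem_uIcc).const_add (x t₀)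
    refine h5.congr_of_eventuallyEq ?_
    filter_upwards [Icc_mem_nhds hs1 hs2] with t ht using hxint t ht

lemma inner_integral_le [FiniteDimensional ℝ E] {x' : ℝ → E} {a b β : ℝ} (hab : a ≤ b)
    (hint : IntervalIntegrable x' volume a b) (v : E)
    (h : ∀ᵐ s, s ∈ Icc a b → ⟪v, x' s⟫ ≤ β) : ⟪v, ∫ s in a..b, x' s⟫ ≤ (b - a) * β := by
  have := FiniteDimensional.proper_real E
  have h1 := (innerSL ℝ v).intervalIntegral_comp_comm hint
  simp only [innerSL_apply_apply] at h1
  rw [← h1]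
  have h2 : IntervalIntegrable (fun s => ⟪v, x' s⟫) volume a b := by
    simpa using (show IntervalIntegrable (fun s => innerSL ℝ v (x' s)) volume a b from
      ⟨(innerSL ℝ v).integrable_comp hint.1, (innerSL ℝ v).integrable_comp hint.2⟩)
  have h3 := intervalIntegral.integral_mono_ae_restrict hab h2
    (intervalIntegrable_const (c := β)) ((ae_restrict_iff' measurableSet_Icc).2 h)
  simpa using h3

end Solutions

section Sufficiency

variable {r L_C M L_G : ℝ} {C : ℝ → Set E} {G : ℝ → E → Set E} {K : Set E}

lemma isClosed_restricted_graph (hC : HypC r L_C C) (hK : IsClosed K) :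
    IsClosed {q : ℝ × E | 0 ≤ q.1 ∧ q.2 ∈ C q.1 ∩ K} := by
  refine IsSeqClosed.isClosed fun u q hu hq => ?_
  have h1 : Tendsto (fun k => (u k).1) atTop (𝓝 q.1) := (continuous_fst.tendsto q).comp hq
  have h2 : Tendsto (fun k => (u k).2) atTop (𝓝 q.2) := (continuous_snd.tendsto q).comp hq
  have hq0 : 0 ≤ q.1 := ge_of_tendsto' h1 fun k => (hu k).1
  refine ⟨hq0, ?_, hK.mem_of_tendsto h2 (Eventually.of_forall fun k => (hu k).2.2)⟩
  rw [(hC.isCompact _ hq0).isClosed.mem_iff_infDist_zero (hC.nonempty _ hq0)]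
  refine le_antisymm ?_ infDist_nonneg
  have h3 : Tendsto (fun k => ‖q.2 - (u k).2‖ + L_C * |(u k).1 - q.1|) atTop
      (𝓝 (‖q.2 - q.2‖ + L_C * |q.1 - q.1|)) :=
    ((tendsto_const_nhds.sub h2).norm).add (((h1.sub_const q.1).abs).const_mul L_C)
  have h4 : infDist q.2 (C q.1) ≤ _ := ge_of_tendsto' h3 fun k => by
    obtain ⟨y, hy, hxy⟩ := hC.exists_near (hu k).1 hq0 (hu k).2.1
    refine (infDist_le_dist_of_mem hy).trans ?_
    rw [dist_eq_norm]
    refine (norm_sub_le_norm_sub_add_norm_sub _ (u k).2 _).trans ?_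
    gcongr
  simpa using h4

lemma exists_weighted_nearest [FiniteDimensional ℝ E] {S : Set (ℝ × E)} (hS : IsClosed S)
    (hne : S.Nonempty) {N : ℝ} (hN : 1 ≤ N) (s : ℝ) (z : E) :
    ∃ m ∈ S, ∀ q ∈ S, N * (s - m.1) ^ 2 + ‖z - m.2‖ ^ 2 ≤ N * (s - q.1) ^ 2 + ‖z - q.2‖ ^ 2 := by
  have := FiniteDimensional.proper_real E
  obtain ⟨q₀, hq₀⟩ := hne
  set f : ℝ × E → ℝ := fun q => N * (s - q.1) ^ 2 + ‖z - q.2‖ ^ 2 with hf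
  have hf0 : ∀ q, 0 ≤ f q := fun q => by simp only [hf]; positivity
  have hfar : ∀ q, q ∉ closedBall (s, z) (1 + f q₀) → f q₀ < f q := by
    intro q hq
    have h0 := hf0 q₀
    rw [mem_closedBall, Prod.dist_eq, max_le_iff, not_and_or, not_le, not_le, Real.dist_eq,
      dist_eq_norm, abs_sub_comm, norm_sub_rev] at hq
    simp only [hf] at h0 ⊢ hq
    rcases hq with hq | hq
    · have := sq_abs (s - q.1)
      have := sq_nonneg ‖z - q.2‖
      nlinarith [sq_nonneg (s - q.1)]
    · have : 0 ≤ N * (s - q.1) ^ 2 := by positivity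
      nlinarith
  have hq₀b : q₀ ∈ closedBall (s, z) (1 + f q₀) := by
    by_contra h
    exact lt_irrefl _ (hfar q₀ h)
  obtain ⟨m, hm, hmin⟩ := ((isCompact_closedBall (s, z) (1 + f q₀)).inter_left hS).exists_isMinOn
    ⟨q₀, hq₀, hq₀b⟩ (f := f) (by simp only [hf]; fun_prop)
  refine ⟨m, hm.1, fun q hq => ?_⟩
  by_cases h : q ∈ closedBall (s, z) (1 + f q₀)
  · exact hmin ⟨hq, h⟩
  · exact (show f m ≤ f q₀ from hmin ⟨hq₀, hq₀b⟩).trans (hfar q h).le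

/-- The gradient of the weighted squared distance at a nearest point is a proximal normal. -/
lemma mem_proxNormalCone2_of_weighted_nearest {S : Set (ℝ × E)} {N s τ : ℝ} {z y : E}
    (hN : 1 ≤ N) (hm : (τ, y) ∈ S)
    (hmin : ∀ q ∈ S, N * (s - τ) ^ 2 + ‖z - y‖ ^ 2 ≤ N * (s - q.1) ^ 2 + ‖z - q.2‖ ^ 2) :
    (N * (s - τ), z - y) ∈ proxNormalCone2 S (τ, y) := by
  refine ⟨hm, N / 2, by positivity, fun q hq => ?_⟩
  have h1 := hmin q hq
  rw [show z - q.2 = (z - y) - (q.2 - y) by abel, norm_sub_sq_real (z - y)] at h1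
  have h2 : ‖q.2 - y‖ ^ 2 ≤ N * ‖q.2 - y‖ ^ 2 := le_mul_of_one_le_left (by positivity) hN
  simp only
  nlinarith

lemma add_inner_le_of_hamiltonian (hr : 0 < r) (hC : HypC r L_C C) (hG : HypG M L_G G)
    {s τ a : ℝ} {z y : E} (hs : 0 ≤ s) (hτ : 0 ≤ τ) (hz : z ∈ C s) (hy : y ∈ C τ)
    (hb : sInf {a : ℝ | ∃ ξ ∈ proxNormalCone (C τ) y, ‖ξ‖ ≤ L_C + M ∧ a = ⟪-ξ, z - y⟫} +
          sSup {b : ℝ | ∃ g ∈ G τ y, b = a + ⟪g, z - y⟫} ≤ 0) {g : E} (hg : g ∈ G τ y) :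
    a + ⟪g, z - y⟫ ≤ (L_C + M) * (L_C * |s - τ|) +
      (L_C + M) / (2 * r) * (‖z - y‖ + L_C * |s - τ|) ^ 2 := by
  have hΛ : 0 ≤ L_C + M := add_nonneg hC.lipschitz_nonneg hG.bound_nonneg
  have h1 : -((L_C + M) * (L_C * |s - τ|) +
      (L_C + M) / (2 * r) * (‖z - y‖ + L_C * |s - τ|) ^ 2) ≤
      sInf {a : ℝ | ∃ ξ ∈ proxNormalCone (C τ) y, ‖ξ‖ ≤ L_C + M ∧ a = ⟪-ξ, z - y⟫} := by
    refine le_csInf ⟨_, 0, ⟨hy, 0, le_rfl, fun w _ => by simp⟩, by simpa using hΛ, rfl⟩ ?_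
    rintro _ ⟨ξ, hξ, hξΛ, rfl⟩
    rw [inner_neg_left, neg_le_neg_iff]
    exact hC.inner_le hr hτ hs hξ hξΛ hz (by simp [abs_sub_comm])
  have h2 : a + ⟪g, z - y⟫ ≤ sSup {b : ℝ | ∃ g ∈ G τ y, b = a + ⟪g, z - y⟫} := by
    refine le_csSup ⟨a + M * ‖z - y‖, ?_⟩ ⟨g, hg, rfl⟩
    rintro _ ⟨g, hg, rfl⟩
    have h3 := hG.bounded _ _ _ hg
    gcongr
    exact (real_inner_le_norm _ _).trans (by gcongr)
  linarith

lemma le_exp_mul_of_discrete_gronwall {a : ℕ → ℝ} {u w : ℝ} {n : ℕ} (hu : 0 ≤ u) (hw : 0 ≤ w)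
    (h0 : a 0 ≤ 0) (h : ∀ k < n, a (k + 1) ≤ (1 + u) * a k + w) :
    ∀ k ≤ n, a k ≤ Real.exp (u * k) * (k * w) := by
  intro k
  induction k with
  | zero => intro _; simpa using h0
  | succ k ih =>
    intro hk
    have h1 := ih (by omega)
    have h2 : Real.exp (u * (k + 1 : ℕ)) = Real.exp (u * k) * Real.exp u := by
      rw [← Real.exp_add]; push_cast; ring_nf
    have h3 : 1 + u ≤ Real.exp u := by linarith [Real.add_one_le_exp u]
    have h4 : 1 ≤ Real.exp (u * (k + 1 : ℕ)) := Real.one_le_exp (by positivity)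
    calc a (k + 1) ≤ (1 + u) * a k + w := h k (by omega)
      _ ≤ Real.exp u * (Real.exp (u * k) * (k * w)) + 1 * w := by
          have : (1 + u) * a k ≤ Real.exp u * (Real.exp (u * k) * (k * w)) :=
            (mul_le_mul_of_nonneg_left h1 (by linarith)).trans
              (mul_le_mul_of_nonneg_right h3 (by positivity))
          linarith
      _ ≤ Real.exp u * (Real.exp (u * k) * (k * w)) + Real.exp (u * (k + 1 : ℕ)) * w := by gcongr
      _ = _ := by rw [h2]; push_cast; ring

end Sufficiency

section Invariance

variable {r L_C M L_G : ℝ} {C : ℝ → Set E} {G : ℝ → E → Set E} {K : Set E}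

lemma step_rate_le {Λ κ L D B e d h N : ℝ} (hΛ : 0 ≤ Λ) (hκ : 0 ≤ κ) (hL : 0 ≤ L) (hD : 0 ≤ D)
    (hB : 0 ≤ B) (he : 0 ≤ e) (hd : 0 ≤ d) (hh : 0 ≤ h) (hh1 : h ≤ 1) (hN : 1 ≤ N) :
    2 * (Λ * (L * e) + κ * (d + L * e) ^ 2 + (D * (e + d + (1 + B) * h) * d +
        (Λ * (L * (e + h) + B * h) + κ * (d + (L * (e + h) + B * h)) ^ 2))) + (N + B ^ 2) * h ≤
      (6 * (2 * κ * (1 + L + B) ^ 2 + D * (1 + L + B)) + 1) * (N * e ^ 2 + d ^ 2) +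
        (4 * Λ ^ 2 * L ^ 2 / N + (6 * (2 * κ * (1 + L + B) ^ 2 + D * (1 + L + B)) +
          2 * Λ * (1 + L + B) + N + B ^ 2) * h) := by
  set P := 1 + L + B with hP
  set S := d + e + h with hS
  have hS0 : 0 ≤ S := by positivity
  have hP0 : 0 ≤ P := by positivity
  have h1 : d + L * e ≤ P * S := by
    rw [hP, hS]; nlinarith [mul_nonneg hL hd, mul_nonneg hL hh, mul_nonneg hB hd,
      mul_nonneg hB he, mul_nonneg hB hh]
  have h2 : d + (L * (e + h) + B * h) ≤ P * S := by
    rw [hP, hS]; nlinarith [mul_nonneg hL hd, mul_nonneg hB hd, mul_nonneg hB he]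
  have h3 : e + d + (1 + B) * h ≤ P * S := by
    rw [hP, hS]; nlinarith [mul_nonneg hL hd, mul_nonneg hL he, mul_nonneg hL hh, mul_nonneg hB hd,
      mul_nonneg hB he]
  have h4 : κ * (d + L * e) ^ 2 ≤ κ * (P * S) ^ 2 := by gcongr
  have h5 : κ * (d + (L * (e + h) + B * h)) ^ 2 ≤ κ * (P * S) ^ 2 := by gcongr
  have h6 : D * (e + d + (1 + B) * h) * d ≤ D * (P * S) * S := by
    have : d ≤ S := by rw [hS]; linarith
    gcongr
  have h7 : S ^ 2 ≤ 3 * (N * e ^ 2 + d ^ 2 + h) := by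
    have : e ^ 2 ≤ N * e ^ 2 := le_mul_of_one_le_left (by positivity) hN
    have : h ^ 2 ≤ h := by nlinarith
    rw [hS]
    nlinarith [sq_nonneg (d - e), sq_nonneg (d - h), sq_nonneg (e - h)]
  have h8 : 4 * (Λ * L * e) ≤ N * e ^ 2 + 4 * Λ ^ 2 * L ^ 2 / N := by
    have hN0 : 0 < N := by linarith
    have : N * e ^ 2 + 4 * Λ ^ 2 * L ^ 2 / N - 4 * (Λ * L * e) = (N * e - 2 * Λ * L) ^ 2 / N := by
      field_simp
      ring
    have : 0 ≤ (N * e - 2 * Λ * L) ^ 2 / N := by positivity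
    linarith
  have h9 : (2 * κ * P ^ 2 + D * P) * S ^ 2 ≤
      (2 * κ * P ^ 2 + D * P) * (3 * (N * e ^ 2 + d ^ 2 + h)) := by gcongr
  have h10 : Λ * (L * h + B * h) ≤ Λ * P * h := by
    rw [hP]
    linear_combination mul_nonneg hΛ hh
  linear_combination 2 * h4 + 2 * h5 + 2 * h6 + h8 + 2 * h9 + 2 * h10 + sq_nonneg d

lemma weighted_dist_step_le [FiniteDimensional ℝ E] (hr : 0 < r) (hC : HypC r L_C C)
    (hG : HypG M L_G G) {s h τ N : ℝ} (hs : 0 ≤ s) (hh : 0 ≤ h) (hh1 : h ≤ 1) (hτ : 0 ≤ τ)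
    (hN : 1 ≤ N) {x x' : ℝ → E} {y : E} (hy : y ∈ C τ)
    (hint : IntervalIntegrable x' volume s (s + h))
    (hlip : ∀ σ ∈ Icc s (s + h), ‖x σ - x s‖ ≤ (L_C + 2 * M) * (σ - s))
    (hx' : x (s + h) - x s = ∫ σ in s..(s + h), x' σ)
    (hincl : ∀ᵐ σ, σ ∈ Icc s (s + h) → ∃ ξ ∈ proxNormalCone (C σ) (x σ), ∃ g ∈ G σ (x σ),
      ‖ξ‖ ≤ L_C + M ∧ x' σ = g - ξ)
    (hham : ∀ g ∈ G τ y, N * (s - τ) + ⟪g, x s - y⟫ ≤ (L_C + M) * (L_C * |s - τ|) +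
      (L_C + M) / (2 * r) * (‖x s - y‖ + L_C * |s - τ|) ^ 2) :
    N * (s + h - τ) ^ 2 + ‖x (s + h) - y‖ ^ 2 ≤ N * (s - τ) ^ 2 + ‖x s - y‖ ^ 2 + h *
      ((6 * (2 * ((L_C + M) / (2 * r)) * (1 + L_C + (L_C + 2 * M)) ^ 2 +
          L_G * (1 + L_C + (L_C + 2 * M))) + 1) * (N * (s - τ) ^ 2 + ‖x s - y‖ ^ 2) +
        (4 * (L_C + M) ^ 2 * L_C ^ 2 / N +
          (6 * (2 * ((L_C + M) / (2 * r)) * (1 + L_C + (L_C + 2 * M)) ^ 2 +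
            L_G * (1 + L_C + (L_C + 2 * M))) + 2 * (L_C + M) * (1 + L_C + (L_C + 2 * M)) +
            N + (L_C + 2 * M) ^ 2) * h)) := by
  have hL := hC.lipschitz_nonneg
  have hM := hG.bound_nonneg
  have hD := hG.lipschitz_nonneg
  set B := L_C + 2 * M with hBdef
  set Λ := L_C + M with hΛdef
  set κ := Λ / (2 * r) with hκdef
  set e := |s - τ| with he
  set d := ‖x s - y‖ with hd
  have hB : 0 ≤ B := by positivity
  have hΛ : 0 ≤ Λ := by positivity
  have hκ : 0 ≤ κ := by positivity
  have hrate := step_rate_le hΛ hκ hL hD hB (abs_nonneg (s - τ)) (norm_nonneg (x s - y)) hh hh1 hN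
  rw [← he, ← hd, he, sq_abs, ← he] at hrate
  set S := Λ * (L_C * e) + κ * (d + L_C * e) ^ 2 + (L_G * (e + d + (1 + B) * h) * d +
    (Λ * (L_C * (e + h) + B * h) + κ * (d + (L_C * (e + h) + B * h)) ^ 2)) with hS
  have hpt : ∀ᵐ σ, σ ∈ Icc s (s + h) → ⟪x s - y, x' σ⟫ ≤ S - N * (s - τ) := by
    filter_upwards [hincl] with σ hσ hmem
    obtain ⟨ξ, hξ, g, hg, hξΛ, hx'σ⟩ := hσ hmem
    obtain ⟨g', hg', hgg'⟩ := hG.exists_near (t := τ) (y := y) hg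
    have hσs : |σ - τ| ≤ e + h := by
      rw [he, show σ - τ = (s - τ) + (σ - s) by ring]
      refine (abs_add_le _ _).trans ?_
      rw [abs_of_nonneg (sub_nonneg.2 hmem.1)]
      linarith [hmem.2]
    have hxσ : ‖x σ - x s‖ ≤ B * h :=
      (hlip σ hmem).trans (mul_le_mul_of_nonneg_left (by linarith [hmem.2]) hB)
    have h1 := hham g' hg'
    have h2 : ⟪x s - y, g - g'⟫ ≤ L_G * (e + d + (1 + B) * h) * d := by
      refine (real_inner_le_norm _ _).trans ?_
      rw [mul_comm]
      have h3 : ‖x σ - y‖ ≤ d + B * h := by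
        rw [hd, show x σ - y = (x s - y) + (x σ - x s) by abel]
        exact (norm_add_le _ _).trans (by linarith)
      refine mul_le_mul_of_nonneg_right (hgg'.trans ?_) (norm_nonneg _)
      refine mul_le_mul_of_nonneg_left ?_ hD
      linarith
    have h4 := hC.inner_le hr (hs.trans hmem.1) hτ hξ hξΛ hy (a' := x s)
      (δ := L_C * (e + h) + B * h) (by gcongr)
    rw [norm_sub_rev y, ← neg_sub (x s) y, inner_neg_right, real_inner_comm] at h4
    have h5 : ⟪x s - y, x' σ⟫ = ⟪g', x s - y⟫ + ⟪x s - y, g - g'⟫ + -⟪x s - y, ξ⟫ := by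
      rw [hx'σ, real_inner_comm (x s - y) g', inner_sub_right (x s - y), inner_sub_right (x s - y)]
      ring
    rw [h5, hS]
    linarith
  have h1 := inner_integral_le (by linarith) hint (x s - y) hpt
  rw [← hx', add_sub_cancel_left] at h1
  have h2 : ‖x (s + h) - x s‖ ^ 2 ≤ B ^ 2 * h ^ 2 := by
    have := hlip (s + h) ⟨by linarith, le_rfl⟩
    rw [add_sub_cancel_left] at this
    rw [← mul_pow]
    gcongr
  have h3 : ‖x (s + h) - y‖ ^ 2 = d ^ 2 + 2 * ⟪x s - y, x (s + h) - x s⟫ +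
      ‖x (s + h) - x s‖ ^ 2 := by
    rw [hd, ← norm_add_sq_real]
    congr 2
    abel
  rw [h3]
  refine le_trans ?_ (add_le_add_right (mul_le_mul_of_nonneg_left hrate hh) _)
  clear_value S B d
  linarith

lemma mem_of_hamiltonian [FiniteDimensional ℝ E] (hr : 0 < r) (hC : HypC r L_C C)
    (hG : HypG M L_G G) (hK : IsClosed K)
    (hham : ∀ t x, 0 ≤ t → x ∈ C t ∩ K →
      ∀ p ∈ proxNormalCone2 {q : ℝ × E | 0 ≤ q.1 ∧ q.2 ∈ C q.1 ∩ K} (t, x),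
        sInf {a : ℝ | ∃ ξ ∈ proxNormalCone (C t) x, ‖ξ‖ ≤ L_C + M ∧ a = ⟪-ξ, p.2⟫} +
          sSup {a : ℝ | ∃ g ∈ G t x, a = p.1 + ⟪g, p.2⟫} ≤ 0)
    {t₀ t : ℝ} (ht₀ : 0 ≤ t₀) (ht : t₀ ≤ t) {x : ℝ → E} (hx : IsSweepingSol C G t₀ t x)
    (hxK : x t₀ ∈ K) : x t ∈ K := by
  have := FiniteDimensional.proper_real E
  have hL := hC.lipschitz_nonneg
  have hM := hG.bound_nonneg
  have hD := hG.lipschitz_nonneg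
  have hx0 : x t₀ ∈ C t₀ := hx.1 t₀ (left_mem_Icc.2 ht)
  obtain ⟨x', hx', hincl⟩ := hx.exists_bounded_reaction hr hC hG ht₀ ht
  have hlip : ∀ a ∈ Icc t₀ t, ∀ b ∈ Icc t₀ t, a ≤ b → ‖x b - x a‖ ≤ (L_C + 2 * M) * (b - a) := by
    intro a ha b hb hab
    rw [(hx' a ha b hb).2, ← abs_of_nonneg (sub_nonneg.2 hab)]
    refine intervalIntegral.norm_integral_le_of_norm_le_const_ae ?_
    filter_upwards [hincl] with s hs hmem
    rw [uIoc_of_le hab] at hmem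
    obtain ⟨ξ, -, g, hg, hξΛ, hx's⟩ := hs ⟨ha.1.trans hmem.1.le, hmem.2.trans hb.2⟩
    rw [hx's]
    refine (norm_sub_le _ _).trans ?_
    linarith [hG.bounded _ _ _ hg]
  set S := {q : ℝ × E | 0 ≤ q.1 ∧ q.2 ∈ C q.1 ∩ K} with hS
  have hSc : IsClosed S := isClosed_restricted_graph hC hK
  have hS0 : (t₀, x t₀) ∈ S := ⟨ht₀, hx0, hxK⟩
  set W := 6 * (2 * ((L_C + M) / (2 * r)) * (1 + L_C + (L_C + 2 * M)) ^ 2 +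
    L_G * (1 + L_C + (L_C + 2 * M))) with hW
  set c := 4 * (L_C + M) ^ 2 * L_C ^ 2 with hc
  have hW0 : 0 ≤ W := by positivity
  have hc0 : 0 ≤ c := by positivity
  set A := Real.exp ((W + 1) * (t - t₀)) * (t - t₀) with hA
  have hA0 : 0 ≤ A := mul_nonneg (Real.exp_pos _).le (sub_nonneg.2 ht)
  have key : ∀ N : ℝ, 1 ≤ N → ∃ y ∈ K, ‖x t - y‖ ^ 2 ≤ A * (c / N) := by
    intro N hN
    choose m hmS hm using fun s => exists_weighted_nearest hSc ⟨_, hS0⟩ hN s (x s)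
    set φ : ℝ → ℝ := fun s => N * (s - (m s).1) ^ 2 + ‖x s - (m s).2‖ ^ 2 with hφ
    set R := W + 2 * (L_C + M) * (1 + L_C + (L_C + 2 * M)) + N + (L_C + 2 * M) ^ 2 with hR
    have hR0 : 0 ≤ R := by positivity
    have hstep : ∀ s h : ℝ, 0 ≤ h → h ≤ 1 → t₀ ≤ s → s + h ≤ t →
        φ (s + h) ≤ φ s + h * ((W + 1) * φ s + (c / N + R * h)) := by
      intro s h hh hh1 hs hsh
      have hsI : s ∈ Icc t₀ t := ⟨hs, by linarith⟩
      have hshI : s + h ∈ Icc t₀ t := ⟨by linarith, hsh⟩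
      have hxs := hx.1 s hsI
      refine (hm (s + h) (m s) (hmS s)).trans ?_
      refine weighted_dist_step_le hr hC hG (ht₀.trans hs) hh hh1 (hmS s).1 hN
        (hmS s).2.1 (hx' s hsI _ hshI).1 (fun σ hσ => hlip s hsI σ
          ⟨hs.trans hσ.1, hσ.2.trans hsh⟩ hσ.1) (hx' s hsI _ hshI).2 ?_ ?_
      · filter_upwards [hincl] with σ h1 h2
        exact h1 ⟨hs.trans h2.1, h2.2.trans hsh⟩
      · intro g hg
        exact add_inner_le_of_hamiltonian hr hC hG (ht₀.trans hs) (hmS s).1 hxs (hmS s).2.1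
          (hham _ _ (hmS s).1 (hmS s).2 _
            (mem_proxNormalCone2_of_weighted_nearest hN (hmS s) (hm s))) hg
    have hφ0 : φ t₀ ≤ 0 := (hm t₀ _ hS0).trans_eq (by simp)
    have hbound : ∀ᶠ n : ℕ in atTop, φ t ≤ A * (c / N + R * ((t - t₀) / n)) := by
      filter_upwards [eventually_ge_atTop (⌈t - t₀⌉₊ + 1)] with n hn
      have hn0 : (0 : ℝ) < n := by exact_mod_cast (by omega : 0 < n)
      have hnΔ : t - t₀ ≤ n := (Nat.le_ceil _).trans (by exact_mod_cast (by omega))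
      set h := (t - t₀) / n with hh
      have hh0 : 0 ≤ h := div_nonneg (sub_nonneg.2 ht) hn0.le
      have hh1 : h ≤ 1 := (div_le_one hn0).2 hnΔ
      have hnh : n * h = t - t₀ := mul_div_cancel₀ _ hn0.ne'
      have h1 := le_exp_mul_of_discrete_gronwall (a := fun k : ℕ => φ (t₀ + k * h))
        (u := (W + 1) * h) (w := h * (c / N + R * h)) (n := n) (by positivity) (by positivity)
        (by simpa using hφ0) (fun k hk => by
          have h2 : ((k : ℝ) + 1) * h ≤ n * h := by
            have : ((k : ℝ) + 1) ≤ n := by exact_mod_cast hk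
            gcongr
          have h3 : 0 ≤ (k : ℝ) * h := by positivity
          have h4 := hstep (t₀ + k * h) h hh0 hh1 (by linarith) (by linarith)
          rw [show t₀ + k * h + h = t₀ + (k + 1 : ℕ) * h by push_cast; ring] at h4
          refine h4.trans_eq ?_
          ring) n le_rfl
      simp only [hnh, add_sub_cancel] at h1
      refine h1.trans_eq ?_
      rw [hA, mul_assoc (W + 1), mul_comm h, hnh, ← mul_assoc (n : ℝ), hnh]
      ring
    have hlim : Tendsto (fun n : ℕ => A * (c / N + R * ((t - t₀) / n))) atTop
        (𝓝 (A * (c / N + R * 0))) :=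
      (((tendsto_const_div_atTop_nhds_zero_nat (t - t₀)).const_mul R).const_add _).const_mul A
    have h1 : φ t ≤ _ := ge_of_tendsto hlim hbound
    rw [mul_zero, add_zero] at h1
    refine ⟨(m t).2, (hmS t).2.2, le_trans ?_ h1⟩
    exact le_add_of_nonneg_left (by positivity)
  rw [← hK.closure_eq, Metric.mem_closure_iff]
  intro ε hε
  obtain ⟨y, hy, hxy⟩ := key (1 + A * c / ε ^ 2)
    (by simp only [le_add_iff_nonneg_right]; positivity)
  refine ⟨y, hy, ?_⟩
  rw [dist_eq_norm]
  refine lt_of_pow_lt_pow_left₀ 2 hε.le (hxy.trans_lt ?_)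
  rw [← mul_div_assoc, div_lt_iff₀ (by positivity), mul_add, mul_div_cancel₀ _ (by positivity)]
  have : 0 < ε ^ 2 := by positivity
  linarith

end Invariance

/-- Hamiltonian characterisation of strong invariance for the perturbed
sweeping process. -/
theorem strong_invariance_iff {n : ℕ} (r L_C M L_G : ℝ) (hr : 0 < r)
    (C : ℝ → Set (EuclideanSpace ℝ (Fin n)))
    (G : ℝ → EuclideanSpace ℝ (Fin n) → Set (EuclideanSpace ℝ (Fin n)))
    (hC : HypC r L_C C) (hG : HypG M L_G G)
    (K : Set (EuclideanSpace ℝ (Fin n))) (hK : IsClosed K)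
    (hKC : ∀ t, 0 ≤ t → (C t ∩ K).Nonempty) :
    -- (a) strong invariance
    (∀ t₀ x₀, 0 ≤ t₀ → x₀ ∈ C t₀ ∩ K →
      ∀ T > t₀, ∀ x : ℝ → EuclideanSpace ℝ (Fin n),
        IsSweepingSol C G t₀ T x → x t₀ = x₀ → ∀ t ∈ Icc t₀ T, x t ∈ K)
    ↔
    -- (b) Hamiltonian inequality
    (∀ t x, 0 ≤ t → x ∈ C t ∩ K →
      ∀ p ∈ proxNormalCone2 {q : ℝ × EuclideanSpace ℝ (Fin n) |
          0 ≤ q.1 ∧ q.2 ∈ C q.1 ∩ K} (t, x),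
        sInf {a : ℝ | ∃ ξ ∈ proxNormalCone (C t) x, ‖ξ‖ ≤ L_C + M ∧ a = ⟪-ξ, p.2⟫} +
          sSup {a : ℝ | ∃ g ∈ G t x, a = p.1 + ⟪g, p.2⟫} ≤ 0) := by
  have hΛ : 0 ≤ L_C + M := add_nonneg hC.lipschitz_nonneg hG.bound_nonneg
  constructor
  · intro hinv t x ht hx p hp
    rw [← le_neg_iff_add_nonpos_left]
    obtain ⟨g₀, hg₀⟩ := hG.nonempty t x
    refine csSup_le ⟨_, g₀, hg₀, rfl⟩ ?_
    rintro _ ⟨g, hg, rfl⟩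
    obtain ⟨ξ, hξ, hξΛ, hle⟩ := exists_reaction_of_invariance hr hC hG ht hx.1
      (fun T hT y hy hyt => hinv t x ht hx T hT y hy hyt) hp hg
    have hinf : sInf {a : ℝ | ∃ ξ ∈ proxNormalCone (C t) x, ‖ξ‖ ≤ L_C + M ∧ a = ⟪-ξ, p.2⟫} ≤
        ⟪-ξ, p.2⟫ := by
      refine csInf_le ⟨-((L_C + M) * ‖p.2‖), ?_⟩ ⟨ξ, hξ, hξΛ, rfl⟩
      rintro _ ⟨η, -, hη, rfl⟩
      rw [inner_neg_left, neg_le_neg_iff]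
      exact (real_inner_le_norm _ _).trans (by gcongr)
    linarith
  · intro hham t₀ x₀ ht₀ hx₀ T _ x hx hxt₀ t ht
    obtain ⟨hxC, x', hx'int, hx', hincl⟩ := hx
    have hsub : Icc t₀ t ⊆ Icc t₀ T := Icc_subset_Icc_right ht.2
    exact mem_of_hamiltonian hr hC hG hK hham ht₀ ht.1
      ⟨fun s hs => hxC s (hsub hs), x', hx'int.mono_set hsub, fun s hs => hx' s (hsub hs),
        ae_restrict_of_ae_restrict_of_subset hsub hincl⟩ (hxt₀ ▸ hx₀.2)
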